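/- For every real number q with 0 < q < 1, the τ-twisted character of the vacuum module W(0) of W₃(4/5) has the Rogers–Ramanujan product form: χ_{5,6}^{2,1}(q) − χ_{5,6}^{2,5}(q) = q^{11/30} · ∏_{n=0}^∞ 1/((1 − q^{10n+4})(1 − q^{10n+6})). -/

import Mathlib

open scoped BigOperators

/-- The Euler product `(q)_∞ = ∏_{i=1}^∞ (1 - q^i)`. -/
noncomputable def eulerProd (q : ℝ) : ℝ := ∏' i : ℕ, (1 - q ^ (i + 1))

/-- The Virasoro minimal model character `χ_{s,t}^{m,n}(q)`:
`q^(h - c/24) · (q)_∞⁻¹ · Σ_{k∈ℤ} q^(s t k²) (q^(k(mt-ns)) - q^((mt+ns)k+mn))`,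
where `c = 1 - 6(s-t)²/(st)` and `h = ((mt-ns)² - (s-t)²)/(4st)`. -/
noncomputable def minChar (s t m n : ℤ) (q : ℝ) : ℝ :=
  q ^ ((((((m * t - n * s) ^ 2 - (s - t) ^ 2 : ℤ) : ℝ)) / (4 * (s : ℝ) * (t : ℝ))) -
        (1 - 6 * ((s : ℝ) - (t : ℝ)) ^ 2 / ((s : ℝ) * (t : ℝ))) / 24) *
    (eulerProd q)⁻¹ *
    ∑' k : ℤ, ((q ^ (s * t * k ^ 2 + k * (m * t - n * s)) : ℝ) -
               (q ^ (s * t * k ^ 2 + (m * t + n * s) * k + m * n) : ℝ))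

open Filter Topology

/-- The finite `q`-Pochhammer symbol `(a; p)_n = ∏_{i < n} (1 - a p^i)`. -/
noncomputable def qPoch (p a : ℝ) (n : ℕ) : ℝ := ∏ i ∈ Finset.range n, (1 - a * p ^ i)

/-- The Gaussian binomial coefficient, defined by its `q`-Pascal recurrence. -/
noncomputable def gaussBinom (p : ℝ) : ℕ → ℕ → ℝ
  | _, 0 => 1
  | 0, _ + 1 => 0
  | n + 1, k + 1 => gaussBinom p n k + p ^ (k + 1) * gaussBinom p n (k + 1)

@[simp] lemma gaussBinom_zero_right (p : ℝ) (n : ℕ) : gaussBinom p n 0 = 1 := by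
  cases n <;> simp [gaussBinom]

lemma gaussBinom_succ_succ (p : ℝ) (n k : ℕ) :
    gaussBinom p (n + 1) (k + 1) = gaussBinom p n k + p ^ (k + 1) * gaussBinom p n (k + 1) := by
  simp [gaussBinom]

lemma gaussBinom_eq_zero_of_lt (p : ℝ) {n k : ℕ} (h : n < k) : gaussBinom p n k = 0 := by
  induction n generalizing k with
  | zero => obtain ⟨k, rfl⟩ := Nat.exists_eq_add_of_lt h; simp [gaussBinom]
  | succ n ih =>
    obtain ⟨k, rfl⟩ := Nat.exists_eq_succ_of_ne_zero (by omega : k ≠ 0)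
    rw [gaussBinom_succ_succ, ih (by omega), ih (by omega)]
    simp

lemma gaussBinom_succ_right (p : ℝ) (n k : ℕ) :
    p ^ k * gaussBinom p n (k + 1) * (1 - p ^ (k + 1)) =
      gaussBinom p n k * (p ^ k - p ^ n) := by
  induction n generalizing k with
  | zero => cases k <;> simp [gaussBinom]
  | succ n ih =>
    cases k with
    | zero =>
      have h := ih 0
      simp only [gaussBinom_succ_succ, gaussBinom_zero_right, zero_add, pow_zero] at h ⊢
      linear_combination p * h
    | succ k =>
      have h := ih k
      have h' := ih (k + 1)
      simp only [gaussBinom_succ_succ]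
      linear_combination p * h + p ^ (k + 2) * h'

@[simp] lemma qPoch_zero (p a : ℝ) : qPoch p a 0 = 1 := by simp [qPoch]

lemma qPoch_succ (p a : ℝ) (n : ℕ) : qPoch p a (n + 1) = qPoch p a n * (1 - a * p ^ n) := by
  simp [qPoch, Finset.prod_range_succ]

lemma qPoch_succ' (p a : ℝ) (n : ℕ) : qPoch p a (n + 1) = (1 - a) * qPoch p (a * p) n := by
  simp only [qPoch, Finset.prod_range_succ', pow_zero, mul_one, mul_comm (1 - a)]
  congr 1
  exact Finset.prod_congr rfl fun i _ => by ring

lemma qPoch_ne_zero {p a : ℝ} (h : ∀ i, a * p ^ i ≠ 1) (n : ℕ) : qPoch p a n ≠ 0 :=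
  Finset.prod_ne_zero_iff.mpr fun i _ => sub_ne_zero.mpr (h i).symm

lemma gaussBinom_mul_qPoch {p : ℝ} (hp : p ≠ 0) (k l : ℕ) :
    gaussBinom p (k + l) k * (qPoch p p k * qPoch p p l) = qPoch p p (k + l) := by
  induction k generalizing l with
  | zero => simp
  | succ k ih =>
    have h := gaussBinom_succ_right p (k + 1 + l) k
    have h' := ih (l + 1)
    rw [show k + (l + 1) = k + 1 + l by ring, qPoch_succ p p l] at h'
    have h'' : gaussBinom p (k + 1 + l) (k + 1) * (1 - p ^ (k + 1)) =
        gaussBinom p (k + 1 + l) k * (1 - p ^ (l + 1)) :=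
      mul_left_cancel₀ (pow_ne_zero k hp) (by linear_combination h)
    rw [← h', qPoch_succ p p k]
    linear_combination (qPoch p p k * qPoch p p l) * h''

/-- The summand of the terminating form of the quintuple product identity. -/
noncomputable def quintTerm (p z : ℝ) (n k : ℕ) : ℝ :=
  (1 + z * p ^ k) * gaussBinom p n k * qPoch p z (n + 1) / qPoch p (z ^ 2 * p ^ k) (n + 1) *
    z ^ k * p ^ (k ^ 2)

lemma sum_quintTerm_succ_sub {p z : ℝ} (hz : ∀ i, z ^ 2 * p ^ i ≠ 1) (n K : ℕ) :
    ∑ k ∈ Finset.range (K + 1), (quintTerm p z (n + 1) k - quintTerm p z n k) =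
      -(p ^ (n + 1 + K + K ^ 2) * z ^ (K + 1) * gaussBinom p n K * qPoch p z (n + 1) /
        qPoch p (z ^ 2 * p ^ (K + 1)) (n + 1)) := by
  have h1 (i : ℕ) : 1 - z ^ 2 * p ^ i ≠ 0 := sub_ne_zero.mpr (hz i).symm
  have hE (k : ℕ) : qPoch p (z ^ 2 * p ^ k) n ≠ 0 :=
    qPoch_ne_zero (fun i => by rw [mul_assoc, ← pow_add]; exact hz _) n
  induction K with
  | zero =>
    have e1 := h1 0
    have e2 := h1 (n + 1)
    have e3 := hE 1
    have a1 : qPoch p (z ^ 2) (n + 1) = (1 - z ^ 2) * qPoch p (z ^ 2 * p) n := qPoch_succ' ..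
    have a2 : qPoch p (z ^ 2) (n + 1 + 1) =
        (1 - z ^ 2) * (qPoch p (z ^ 2 * p) n * (1 - z ^ 2 * p ^ (n + 1))) := by
      rw [qPoch_succ', qPoch_succ]; ring
    have a3 : qPoch p (z ^ 2 * p) (n + 1) = qPoch p (z ^ 2 * p) n * (1 - z ^ 2 * p ^ (n + 1)) := by
      rw [qPoch_succ]; ring
    simp only [zero_add, Finset.range_one, Finset.sum_singleton, quintTerm, pow_zero, mul_one,
      gaussBinom_zero_right, pow_one, a1, a2, a3, qPoch_succ p z (n + 1)] at *
    field_simp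
    ring
  | succ k ih =>
    rw [Finset.sum_range_succ, ih]
    have e1 := h1 (k + 1)
    have e2 := h1 (k + 1 + (n + 1))
    have e3 := hE (k + 2)
    have a1 : qPoch p (z ^ 2 * p ^ (k + 1)) (n + 1) =
        (1 - z ^ 2 * p ^ (k + 1)) * qPoch p (z ^ 2 * p ^ (k + 2)) n := by
      rw [qPoch_succ']; ring_nf
    have a2 : qPoch p (z ^ 2 * p ^ (k + 1)) (n + 1 + 1) = (1 - z ^ 2 * p ^ (k + 1)) *
        (qPoch p (z ^ 2 * p ^ (k + 2)) n * (1 - z ^ 2 * p ^ (k + 1 + (n + 1)))) := by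
      rw [qPoch_succ', qPoch_succ]; ring_nf
    have a3 : qPoch p (z ^ 2 * p ^ (k + 1 + 1)) (n + 1) =
        qPoch p (z ^ 2 * p ^ (k + 2)) n * (1 - z ^ 2 * p ^ (k + 1 + (n + 1))) := by
      rw [qPoch_succ]; ring
    have h := gaussBinom_succ_right p n k
    simp only [quintTerm, a1, a2, a3, qPoch_succ p z (n + 1), gaussBinom_succ_succ]
    generalize qPoch p (z ^ 2 * p ^ (k + 2)) n = E at *
    generalize qPoch p z (n + 1) = Z at *
    generalize gaussBinom p n k = A at *
    generalize gaussBinom p n (k + 1) = B at *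
    rw [show p ^ ((k + 1) ^ 2) = p ^ (k ^ 2 + k + 1) * p ^ k by ring,
      show p ^ (n + 1 + k + k ^ 2) = p ^ (k ^ 2 + k + 1) * p ^ n by ring,
      show p ^ (n + 1 + (k + 1) + (k + 1) ^ 2) =
        p ^ (k ^ 2 + k + 1) * p ^ n * (p ^ k) ^ 2 * p ^ 2 by ring]
    rw [show p ^ (k + 1 + (n + 1)) = p ^ 2 * p ^ k * p ^ n by ring] at *
    simp only [pow_succ p k, pow_succ p n, pow_succ z (k + 1)] at *
    generalize p ^ (k ^ 2 + k + 1) = s at *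
    generalize p ^ k = x at *
    generalize p ^ n = Q at *
    generalize z ^ (k + 1) = w at *
    have e1' : 1 - z ^ 2 * x * p ≠ 0 := by convert e1 using 1; ring
    have e2' : 1 - Q * z ^ 2 * x * p ^ 2 ≠ 0 := by convert e2 using 1; ring
    rw [← sub_eq_zero]
    field_simp
    linear_combination (-s * w * Z) * (1 + z * p * x - z ^ 2 * p ^ 2 * x * Q) * h

lemma sum_quintTerm {p z : ℝ} (hz : ∀ i, z ^ 2 * p ^ i ≠ 1) (n : ℕ) :
    ∑ k ∈ Finset.range (n + 1), quintTerm p z n k = 1 := by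
  induction n with
  | zero =>
    have h := hz 0
    have : 1 - z ^ 2 ≠ 0 := sub_ne_zero.mpr (by simpa using h.symm)
    simp [quintTerm, qPoch_succ]
    field_simp
    ring
  | succ n ih =>
    have h := sum_quintTerm_succ_sub hz n (n + 1)
    rw [gaussBinom_eq_zero_of_lt p (Nat.lt_succ_self n), Finset.sum_sub_distrib,
      Finset.sum_range_succ (quintTerm p z n), ih] at h
    have h0 : quintTerm p z n (n + 1) = 0 := by
      simp [quintTerm, gaussBinom_eq_zero_of_lt p (Nat.lt_succ_self n)]
    simp only [h0, mul_zero, zero_mul, zero_div, neg_zero] at h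
    linarith

lemma qPoch_div_pow {p z : ℝ} (hp : 0 < p) (hz : z ≠ 0) (m n : ℕ) :
    qPoch p (z / p ^ m) (m + n) =
      qPoch p z n * qPoch p (p / z) m * (-z) ^ m * p ^ (-(m * (m + 1) / 2) : ℝ) := by
  induction m with
  | zero => simp
  | succ m ih =>
    rw [show m + 1 + n = m + n + 1 by ring, qPoch_succ',
      show z / p ^ (m + 1) * p = z / p ^ m by rw [pow_succ]; field_simp, ih, qPoch_succ p (p / z) m,
      show (-((m + 1 : ℕ) * ((m + 1 : ℕ) + 1) / 2) : ℝ) = -(m * (m + 1) / 2) - (m + 1 : ℕ) by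
        push_cast; ring, Real.rpow_sub hp, Real.rpow_natCast]
    field_simp
    ring

/-- The infinite `q`-Pochhammer symbol `(a; p)_∞`. -/
noncomputable def qPochInf (p a : ℝ) : ℝ := ∏' i : ℕ, (1 - a * p ^ i)

lemma summable_norm_neg_mul_pow {p : ℝ} (hp0 : 0 ≤ p) (hp1 : p < 1) (a : ℝ) :
    Summable fun i : ℕ => ‖-(a * p ^ i)‖ := by
  simpa using ((summable_geometric_of_lt_one hp0 hp1).mul_left a).norm

lemma tendsto_qPoch {p : ℝ} (hp0 : 0 ≤ p) (hp1 : p < 1) (a : ℝ) :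
    Tendsto (qPoch p a) atTop (𝓝 (qPochInf p a)) := by
  have := multipliable_one_add_of_summable (summable_norm_neg_mul_pow hp0 hp1 a)
  simp only [← sub_eq_add_neg] at this
  exact this.tendsto_prod_tprod_nat

lemma qPochInf_ne_zero {p : ℝ} (hp0 : 0 ≤ p) (hp1 : p < 1) {a : ℝ} (h : ∀ i, a * p ^ i ≠ 1) :
    qPochInf p a ≠ 0 := by
  have := tprod_one_add_ne_zero_of_summable (f := fun i : ℕ => -(a * p ^ i))
    (fun i => by rw [← sub_eq_add_neg]; exact sub_ne_zero.mpr (h i).symm)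
    (summable_norm_neg_mul_pow hp0 hp1 a)
  simpa [qPochInf, sub_eq_add_neg] using this

lemma mul_pow_lt_one {p a : ℝ} (hp0 : 0 ≤ p) (hp1 : p < 1) (ha0 : 0 ≤ a) (ha1 : a < 1) (i : ℕ) :
    a * p ^ i < 1 :=
  (mul_le_of_le_one_right ha0 (pow_le_one₀ hp0 hp1.le)).trans_lt ha1

lemma qPoch_pos {p a : ℝ} (hp0 : 0 ≤ p) (hp1 : p < 1) (ha0 : 0 ≤ a) (ha1 : a < 1) (n : ℕ) :
    0 < qPoch p a n :=
  Finset.prod_pos fun i _ => sub_pos.mpr (mul_pow_lt_one hp0 hp1 ha0 ha1 i)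

lemma antitone_qPoch {p a : ℝ} (hp0 : 0 ≤ p) (hp1 : p < 1) (ha0 : 0 ≤ a) (ha1 : a < 1) :
    Antitone (qPoch p a) := antitone_nat_of_succ_le fun n => by
  rw [qPoch_succ]
  exact mul_le_of_le_one_right (qPoch_pos hp0 hp1 ha0 ha1 n).le
    (sub_le_self _ (by positivity))

lemma qPochInf_le_qPoch {p a : ℝ} (hp0 : 0 ≤ p) (hp1 : p < 1) (ha0 : 0 ≤ a) (ha1 : a < 1)
    (n : ℕ) : qPochInf p a ≤ qPoch p a n :=
  (antitone_qPoch hp0 hp1 ha0 ha1).le_of_tendsto (tendsto_qPoch hp0 hp1 a) n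

lemma qPochInf_pos {p a : ℝ} (hp0 : 0 ≤ p) (hp1 : p < 1) (ha0 : 0 ≤ a) (ha1 : a < 1) :
    0 < qPochInf p a :=
  (ge_of_tendsto' (tendsto_qPoch hp0 hp1 a) fun n => (qPoch_pos hp0 hp1 ha0 ha1 n).le).lt_of_ne'
    (qPochInf_ne_zero hp0 hp1 fun i => (mul_pow_lt_one hp0 hp1 ha0 ha1 i).ne)

lemma qPoch_le_one {p a : ℝ} (hp0 : 0 ≤ p) (hp1 : p < 1) (ha0 : 0 ≤ a) (ha1 : a < 1) (n : ℕ) :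
    qPoch p a n ≤ 1 := by
  simpa using antitone_qPoch hp0 hp1 ha0 ha1 (Nat.zero_le n)

lemma one_le_qPoch_neg {p a : ℝ} (hp0 : 0 ≤ p) (ha0 : 0 ≤ a) (n : ℕ) : 1 ≤ qPoch p (-a) n := by
  induction n with
  | zero => simp
  | succ n ih =>
    rw [qPoch_succ]
    have : 0 ≤ a * p ^ n := by positivity
    exact one_le_mul_of_one_le_of_one_le ih (by linarith)

lemma qPoch_neg_le_qPochInf {p a : ℝ} (hp0 : 0 ≤ p) (hp1 : p < 1) (ha0 : 0 ≤ a) (n : ℕ) :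
    qPoch p (-a) n ≤ qPochInf p (-a) := by
  refine Monotone.ge_of_tendsto (monotone_nat_of_le_succ fun n => ?_)
    (tendsto_qPoch hp0 hp1 (-a)) n
  rw [qPoch_succ]
  have : 0 ≤ a * p ^ n := by positivity
  exact le_mul_of_one_le_right (zero_le_one.trans (one_le_qPoch_neg hp0 ha0 n)) (by linarith)

/-- The general term of the quintuple product series. -/
noncomputable def quintSeriesTerm (p u x : ℝ) : ℝ :=
  u ^ (3 * x) * p ^ ((3 * x ^ 2 - x) / 2) - u ^ (3 * x + 1) * p ^ ((3 * x ^ 2 + x) / 2)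

/-- The factor by which the recentred terms of the finite identity differ from the series terms. -/
noncomputable def quintWeight (p u : ℝ) (m k l : ℕ) : ℝ :=
  qPoch p p (2 * m) * qPoch p (-u) (m + 1) * qPoch p (-(p / u)) m /
    (qPoch p p k * qPoch p p l * (qPoch p (u ^ 2) (k + 1) * qPoch p (p / u ^ 2) l))

lemma quintTerm_recentred {p u : ℝ} (hp0 : 0 < p) (hp1 : p < 1) (hu0 : 0 < u) (hu1 : u < 1)
    (hpu : p < u ^ 2) {m k l : ℕ} (hkl : k + l = 2 * m) :
    quintTerm p (-u / p ^ m) (2 * m) k = quintSeriesTerm p u (k - m) * quintWeight p u m k l := by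
  have h1 : (-u / p ^ m) ^ 2 * p ^ k = u ^ 2 / p ^ l := by
    have : p ^ k * p ^ l = (p ^ m) ^ 2 := by rw [← pow_add, hkl, ← pow_mul, mul_comm m]
    field_simp
    linear_combination this
  have hu2 : p / u ^ 2 < 1 := (div_lt_one (by positivity)).mpr hpu
  have hu3 : u ^ 2 < 1 := pow_lt_one₀ hu0.le hu1 two_ne_zero
  have n1 := (qPoch_pos hp0.le hp1 hp0.le hp1 k).ne'
  have n2 := (qPoch_pos hp0.le hp1 hp0.le hp1 l).ne'
  have n3 := (qPoch_pos hp0.le hp1 (by positivity) hu3 (k + 1)).ne'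
  have n4 := (qPoch_pos hp0.le hp1 (by positivity) hu2 l).ne'
  have hb := gaussBinom_mul_qPoch hp0.ne' k l
  have hq : quintSeriesTerm p u (k - m) * ((-u ^ 2) ^ l * p ^ (-(l * (l + 1) / 2) : ℝ)) =
      (1 + -u / p ^ m * p ^ k) * (u ^ m * p ^ (-(m * (m + 1) / 2) : ℝ)) *
        (-u / p ^ m) ^ k * p ^ (k ^ 2) := by
    have hl : (l : ℝ) = 2 * m - k := by
      rw [eq_sub_iff_add_eq', ← Nat.cast_add, hkl]; simp
    have hs : (-1 : ℝ) ^ l = (-1) ^ k := by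
      have : (-1 : ℝ) ^ k * (-1) ^ l = 1 := by rw [← pow_add, hkl]; simp
      have h2 : (-1 : ℝ) ^ k * (-1) ^ k = 1 := by rw [← mul_pow]; simp
      linear_combination (-1) ^ k * this - (-1) ^ l * h2
    obtain ⟨a, rfl⟩ : ∃ a, Real.exp a = u := ⟨_, Real.exp_log hu0⟩
    obtain ⟨b, rfl⟩ : ∃ b, Real.exp b = p := ⟨_, Real.exp_log hp0⟩
    rw [neg_pow, hs, neg_div, neg_pow (_ / _), quintSeriesTerm]
    simp only [← Real.exp_mul, ← Real.exp_nat_mul, ← Real.exp_sub, ← Real.exp_add, hl, neg_mul]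
    rw [← sub_eq_add_neg]
    simp only [mul_assoc, mul_left_comm _ ((-1 : ℝ) ^ k), sub_mul, one_mul, ← Real.exp_add]
    congr 3 <;> push_cast <;> ring
  rw [quintTerm, h1, show 2 * m + 1 = m + (m + 1) by ring, qPoch_div_pow hp0 (by linarith),
    show m + (m + 1) = l + (k + 1) by omega, qPoch_div_pow hp0 (by positivity), quintWeight,
    ← hkl, ← hb]
  have hY : (-u ^ 2) ^ l * p ^ (-(l * (l + 1) / 2) : ℝ) ≠ 0 :=
    mul_ne_zero (pow_ne_zero _ (by simpa using hu0.ne')) (Real.rpow_pos_of_pos hp0 _).ne'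
  rw [div_neg, neg_neg, eq_div_of_mul_eq hY hq, mul_assoc _ ((-u ^ 2) ^ l)]
  generalize (-u ^ 2) ^ l * p ^ (-(l * (l + 1) / 2) : ℝ) = Y at hY
  generalize p ^ (-(m * (m + 1) / 2) : ℝ) = X
  generalize (-u / p ^ m) ^ k = V
  generalize -u / p ^ m * p ^ k = W
  field_simp

lemma summable_rpow_quadratic {q a : ℝ} (hq0 : 0 < q) (hq1 : q < 1) (ha : 0 < a) (b c : ℝ) :
    Summable fun j : ℤ => q ^ (a * j ^ 2 + b * j + c) := by
  obtain ⟨t, rfl⟩ : ∃ t, Real.exp t = q := ⟨_, Real.exp_log hq0⟩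
  have ht : 0 < -t := by simpa using hq1
  have h := summable_pow_mul_jacobiTheta₂_term_bound (|t * b| / (2 * Real.pi))
    (T := -t * a / Real.pi) (by positivity) 0
  refine (h.mul_left (Real.exp (t * c))).of_nonneg_of_le (fun j => by positivity) fun j => ?_
  rw [pow_zero, one_mul, ← Real.exp_mul, ← Real.exp_add, Real.exp_le_exp]
  have h1 : t * b * j ≤ |t * b| * |(j : ℝ)| := (le_abs_self _).trans_eq (abs_mul _ _)
  have h2 : -Real.pi * (-t * a / Real.pi * (j : ℝ) ^ 2 -
      2 * (|t * b| / (2 * Real.pi)) * (|j| : ℤ)) = t * a * j ^ 2 + |t * b| * |(j : ℝ)| := by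
    push_cast
    field_simp
    ring
  rw [h2]
  linarith

lemma summable_quintSeriesTerm {p u : ℝ} (hp0 : 0 < p) (hp1 : p < 1) (hu0 : 0 < u) :
    Summable fun j : ℤ => quintSeriesTerm p u j := by
  have hlog : Real.log p ≠ 0 := (Real.log_neg hp0 hp1).ne
  have hu (x : ℝ) : u ^ x = p ^ (Real.log u / Real.log p * x) := by
    rw [Real.rpow_def_of_pos hu0, Real.rpow_def_of_pos hp0]
    congr 1
    field_simp
  have h (b c : ℝ) := summable_rpow_quadratic hp0 hp1 (a := 3 / 2) (by norm_num) b c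
  refine ((h (Real.log u / Real.log p * 3 - 1 / 2) 0).sub
    (h (Real.log u / Real.log p * 3 + 1 / 2) (Real.log u / Real.log p))).congr fun j => ?_
  rw [quintSeriesTerm, hu, hu, ← Real.rpow_add hp0, ← Real.rpow_add hp0]
  ring_nf

lemma quintWeight_nonneg {p u : ℝ} (hp0 : 0 < p) (hp1 : p < 1) (hu0 : 0 < u) (hu1 : u < 1)
    (hpu : p < u ^ 2) (m k l : ℕ) : 0 ≤ quintWeight p u m k l := by
  have hu2 : p / u ^ 2 < 1 := (div_lt_one (by positivity)).mpr hpu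
  have hu3 : u ^ 2 < 1 := pow_lt_one₀ hu0.le hu1 two_ne_zero
  have h1 (n : ℕ) := (qPoch_pos hp0.le hp1 hp0.le hp1 n).le
  have h2 := (qPoch_pos hp0.le hp1 (by positivity) hu3 (k + 1)).le
  have h3 := (qPoch_pos hp0.le hp1 (by positivity) hu2 l).le
  have h4 := zero_le_one.trans (one_le_qPoch_neg hp0.le hu0.le (m + 1))
  have h5 := zero_le_one.trans (one_le_qPoch_neg hp0.le (div_pos hp0 hu0).le m)
  exact div_nonneg (mul_nonneg (mul_nonneg (h1 _) h4) h5)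
    (mul_nonneg (mul_nonneg (h1 _) (h1 _)) (mul_nonneg h2 h3))

lemma quintWeight_le {p u : ℝ} (hp0 : 0 < p) (hp1 : p < 1) (hu0 : 0 < u) (hu1 : u < 1)
    (hpu : p < u ^ 2) (m k l : ℕ) :
    quintWeight p u m k l ≤ 1 * qPochInf p (-u) * qPochInf p (-(p / u)) /
      (qPochInf p p * qPochInf p p * (qPochInf p (u ^ 2) * qPochInf p (p / u ^ 2))) := by
  have hu2 : p / u ^ 2 < 1 := (div_lt_one (by positivity)).mpr hpu
  have hu3 : u ^ 2 < 1 := pow_lt_one₀ hu0.le hu1 two_ne_zero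
  have hu4 : 0 ≤ p / u := by positivity
  have i1 := qPochInf_pos hp0.le hp1 hp0.le hp1
  have i2 := qPochInf_pos hp0.le hp1 (by positivity) hu3
  have i3 := qPochInf_pos hp0.le hp1 (by positivity) hu2
  have h4 := zero_le_one.trans (one_le_qPoch_neg hp0.le hu0.le (m + 1))
  have h5 := zero_le_one.trans (one_le_qPoch_neg hp0.le hu4 m)
  have i4 := h4.trans (qPoch_neg_le_qPochInf hp0.le hp1 hu0.le (m + 1))
  have i5 := h5.trans (qPoch_neg_le_qPochInf hp0.le hp1 hu4 m)
  have h1 (n : ℕ) := (qPoch_pos hp0.le hp1 hp0.le hp1 n).le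
  unfold quintWeight
  gcongr
  · exact qPoch_le_one hp0.le hp1 hp0.le hp1 _
  · exact qPoch_neg_le_qPochInf hp0.le hp1 hu0.le _
  · exact qPoch_neg_le_qPochInf hp0.le hp1 hu4 _
  · exact mul_nonneg (h1 _) (h1 _)
  · exact h1 _
  · exact qPochInf_le_qPoch hp0.le hp1 hp0.le hp1 _
  · exact qPochInf_le_qPoch hp0.le hp1 hp0.le hp1 _
  · exact (qPoch_pos hp0.le hp1 (by positivity) hu3 _).le
  · exact qPochInf_le_qPoch hp0.le hp1 (by positivity) hu3 _
  · exact qPochInf_le_qPoch hp0.le hp1 (by positivity) hu2 _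

lemma sum_quintSeriesTerm_mul_quintWeight {p u : ℝ} (hp0 : 0 < p) (hp1 : p < 1) (hu0 : 0 < u)
    (hu1 : u < 1) (hpu : p < u ^ 2) (m : ℕ) :
    ∑ j ∈ Finset.Icc (-m : ℤ) m,
      quintSeriesTerm p u j * quintWeight p u m (m + j).toNat (m - j).toNat = 1 := by
  have hz (i : ℕ) : (-u / p ^ m) ^ 2 * p ^ i ≠ 1 := by
    have key : (-u / p ^ m) ^ 2 * p ^ i = u ^ 2 * p ^ i / p ^ (2 * m) := by
      field_simp
      ring
    rw [key, Ne, div_eq_one_iff_eq (by positivity)]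
    rcases lt_or_ge i (2 * m) with h | h
    · refine ne_of_gt ?_
      calc p ^ (2 * m) ≤ p ^ (i + 1) := pow_le_pow_of_le_one hp0.le hp1.le h
        _ = p * p ^ i := pow_succ' _ _
        _ < u ^ 2 * p ^ i := by gcongr
    · refine ne_of_lt ?_
      calc u ^ 2 * p ^ i < 1 * p ^ i := by
            gcongr
            exact pow_lt_one₀ hu0.le hu1 two_ne_zero
        _ ≤ p ^ (2 * m) := by rw [one_mul]; exact pow_le_pow_of_le_one hp0.le hp1.le h
  rw [← sum_quintTerm hz (2 * m)]
  refine Finset.sum_nbij' (fun j => (m + j).toNat) (fun k => (k : ℤ) - m) ?_ ?_ ?_ ?_ ?_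
  · intro j hj; simp only [Finset.mem_Icc, Finset.mem_range] at *; omega
  · intro j hj; simp only [Finset.mem_Icc, Finset.mem_range] at *; omega
  · intro j hj; simp only [Finset.mem_Icc] at *; omega
  · intro j hj; simp only [Finset.mem_range] at *; omega
  · intro j hj
    rw [Finset.mem_Icc] at hj
    rw [quintTerm_recentred hp0 hp1 hu0 hu1 hpu (l := (m - j).toNat) (by omega)]
    congr 2
    have : (((m + j).toNat : ℤ) : ℝ) = ((m + j : ℤ) : ℝ) := by
      rw [Int.toNat_of_nonneg (by omega)]
    rw [Int.cast_natCast] at this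
    rw [this]
    push_cast
    ring

/-- The quintuple product identity, in the form with denominators. -/
theorem tsum_quintSeriesTerm {p u : ℝ} (hp0 : 0 < p) (hp1 : p < 1) (hu0 : 0 < u)
    (hu1 : u < 1) (hpu : p < u ^ 2) :
    ∑' j : ℤ, quintSeriesTerm p u j = qPochInf p p * qPochInf p (u ^ 2) * qPochInf p (p / u ^ 2) /
      (qPochInf p (-u) * qPochInf p (-(p / u))) := by
  have hu2 : p / u ^ 2 < 1 := (div_lt_one (by positivity)).mpr hpu
  have hu3 : u ^ 2 < 1 := pow_lt_one₀ hu0.le hu1 two_ne_zero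
  have i1 := qPochInf_pos hp0.le hp1 hp0.le hp1
  have i2 := qPochInf_pos hp0.le hp1 (by positivity) hu3
  have i3 := qPochInf_pos hp0.le hp1 (by positivity) hu2
  set L := qPochInf p p * qPochInf p (-u) * qPochInf p (-(p / u)) /
      (qPochInf p p * qPochInf p p * (qPochInf p (u ^ 2) * qPochInf p (p / u ^ 2))) with hL
  let f (m : ℕ) (j : ℤ) : ℝ := if j ∈ Finset.Icc (-m : ℤ) m then
    quintSeriesTerm p u j * quintWeight p u m (m + j).toNat (m - j).toNat else 0
  have hf (m : ℕ) : ∑' j, f m j = 1 := by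
    rw [← sum_quintSeriesTerm_mul_quintWeight hp0 hp1 hu0 hu1 hpu m,
      tsum_eq_sum (s := Finset.Icc (-m : ℤ) m) fun j hj => if_neg hj]
    exact Finset.sum_congr rfl fun j hj => if_pos hj
  have hlim (j : ℤ) : Tendsto (fun m => f m j) atTop (𝓝 (quintSeriesTerm p u j * L)) := by
    have t1 : Tendsto (fun m : ℕ => (m + j).toNat) atTop atTop :=
      tendsto_atTop_atTop.mpr fun b => ⟨b + j.natAbs, fun m hm => by omega⟩
    have t2 : Tendsto (fun m : ℕ => (m - j).toNat) atTop atTop :=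
      tendsto_atTop_atTop.mpr fun b => ⟨b + j.natAbs, fun m hm => by omega⟩
    have t3 : Tendsto (fun m : ℕ => 2 * m) atTop atTop :=
      tendsto_atTop_atTop.mpr fun b => ⟨b, fun m hm => by omega⟩
    have t4 := tendsto_add_atTop_nat 1
    have T := tendsto_qPoch hp0.le hp1
    have : Tendsto (fun m : ℕ => quintWeight p u m (m + j).toNat (m - j).toNat) atTop (𝓝 L) :=
      ((((T p).comp t3).mul ((T (-u)).comp t4)).mul (T (-(p / u)))).div
        ((((T p).comp t1).mul ((T p).comp t2)).mul
          (((T (u ^ 2)).comp (t4.comp t1)).mul ((T (p / u ^ 2)).comp t2))) (by positivity)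
    refine (this.const_mul (quintSeriesTerm p u j)).congr' ?_
    filter_upwards [eventually_ge_atTop j.natAbs] with m hm
    exact (if_pos (by rw [Finset.mem_Icc]; omega)).symm
  have hT := tendsto_tsum_of_dominated_convergence
    ((summable_quintSeriesTerm hp0 hp1 hu0).abs.mul_right _) hlim
    (Eventually.of_forall fun m j => show ‖f m j‖ ≤ |quintSeriesTerm p u j| *
      (1 * qPochInf p (-u) * qPochInf p (-(p / u)) /
      (qPochInf p p * qPochInf p p * (qPochInf p (u ^ 2) * qPochInf p (p / u ^ 2)))) by
        have hw := quintWeight_nonneg hp0 hp1 hu0 hu1 hpu m (m + j).toNat (m - j).toNat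
        have hw' := quintWeight_le hp0 hp1 hu0 hu1 hpu m (m + j).toNat (m - j).toNat
        have hC := hw.trans hw'
        by_cases hj : j ∈ Finset.Icc (-m : ℤ) m
        · simp only [f, if_pos hj, norm_mul, Real.norm_eq_abs, abs_of_nonneg hw]
          gcongr
        · simp only [f, if_neg hj, norm_zero]
          positivity)
  simp only [hf, tsum_mul_right] at hT
  have h := tendsto_nhds_unique hT tendsto_const_nhds
  have hne : L ≠ 0 := right_ne_zero_of_mul (h.trans_ne one_ne_zero)
  rw [eq_div_of_mul_eq hne h, hL]
  field_simp

lemma tsum_int_even_add_odd {f : ℤ → ℝ} (hf : Summable f) :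
    ∑' j, f j = ∑' k, f (2 * k) + ∑' k, f (2 * k + 1) := by
  have he : Function.Injective fun k : ℤ => 2 * k := fun a b h => by simpa using h
  have ho : Function.Injective fun k : ℤ => 2 * k + 1 := fun a b h => by simpa using h
  have hc : IsCompl (Set.range fun k : ℤ => 2 * k) (Set.range fun k : ℤ => 2 * k + 1) := by
    have h₀ : (Set.range fun k : ℤ => 2 * k) = {n | Even n} := by
      ext n
      simp [even_iff_exists_two_mul]
    have h₁ : (Set.range fun k : ℤ => 2 * k + 1) = {n | Odd n} := by
      ext n
      simp [Odd]
    rw [h₀, h₁]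
    exact Int.isCompl_even_odd
  exact (HasSum.add_isCompl hc (he.hasSum_range_iff.mpr (hf.comp_injective he).hasSum)
    (ho.hasSum_range_iff.mpr (hf.comp_injective ho).hasSum)).tsum_eq

lemma qPoch_mul_qPoch_neg (p a : ℝ) (n : ℕ) :
    qPoch p a n * qPoch p (-a) n = qPoch (p ^ 2) (a ^ 2) n := by
  simp only [qPoch, ← Finset.prod_mul_distrib]
  exact Finset.prod_congr rfl fun i _ => by ring

lemma qPochInf_mul_qPochInf_neg {p : ℝ} (hp0 : 0 ≤ p) (hp1 : p < 1) (a : ℝ) :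
    qPochInf p a * qPochInf p (-a) = qPochInf (p ^ 2) (a ^ 2) := by
  refine tendsto_nhds_unique ?_
    (tendsto_qPoch (pow_nonneg hp0 2) (pow_lt_one₀ hp0 hp1 two_ne_zero) (a ^ 2))
  simpa only [qPoch_mul_qPoch_neg] using
    (tendsto_qPoch hp0 hp1 a).mul (tendsto_qPoch hp0 hp1 (-a))

lemma qPoch_mul_right (q a : ℝ) (d n : ℕ) :
    qPoch q a (d * n) = ∏ r ∈ Finset.range d, qPoch (q ^ d) (a * q ^ r) n := by
  induction n with
  | zero => simp
  | succ n ih =>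
    simp only [qPoch_succ, Finset.prod_mul_distrib, ← ih]
    rw [qPoch, mul_add, mul_one, Finset.prod_range_add, qPoch]
    congr 1
    exact Finset.prod_congr rfl fun r _ => by ring

lemma qPochInf_dissect {q : ℝ} (hq0 : 0 ≤ q) (hq1 : q < 1) (a : ℝ) {d : ℕ} (hd : d ≠ 0) :
    qPochInf q a = ∏ r ∈ Finset.range d, qPochInf (q ^ d) (a * q ^ r) := by
  refine tendsto_nhds_unique
    ((tendsto_qPoch hq0 hq1 a).comp (tendsto_id.const_mul_atTop' (Nat.pos_of_ne_zero hd))) ?_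
  simp only [Function.comp_def, qPoch_mul_right, id]
  exact tendsto_finsetProd _ fun r _ =>
    tendsto_qPoch (pow_nonneg hq0 d) (pow_lt_one₀ hq0 hq1 hd) _

lemma eulerProd_eq_qPochInf (q : ℝ) : eulerProd q = qPochInf q q := by
  simp only [eulerProd, qPochInf, pow_succ']

/-- The quintuple product identity at base `q ^ 5` and argument `q ^ 2`. -/
lemma tsum_quintSeriesTerm_five_two {q : ℝ} (hq0 : 0 < q) (hq1 : q < 1) :
    ∑' j : ℤ, quintSeriesTerm (q ^ 5) (q ^ 2) j =
      eulerProd q / (qPochInf (q ^ 10) (q ^ 4) * qPochInf (q ^ 10) (q ^ 6)) := by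
  have hp0 : 0 ≤ q ^ 5 := by positivity
  have hp1 : q ^ 5 < 1 := pow_lt_one₀ hq0.le hq1 (by norm_num)
  have hq2 : q ^ 2 < 1 := pow_lt_one₀ hq0.le hq1 (by norm_num)
  have hq3 : q ^ 3 < 1 := pow_lt_one₀ hq0.le hq1 (by norm_num)
  have h2 := qPochInf_mul_qPochInf_neg hp0 hp1 (q ^ 2)
  have h3 := qPochInf_mul_qPochInf_neg hp0 hp1 (q ^ 3)
  have n2 := (qPochInf_pos hp0 hp1 (by positivity) hq2).ne'
  have n3 := (qPochInf_pos hp0 hp1 (by positivity) hq3).ne'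
  have hpu : q ^ 5 < (q ^ 2) ^ 2 := by
    rw [← pow_mul]
    exact pow_lt_pow_right_of_lt_one₀ hq0 hq1 (by norm_num)
  simp only [← pow_mul, Nat.reduceMul] at h2 h3
  rw [tsum_quintSeriesTerm (by positivity) hp1 (by positivity) hq2 hpu, eulerProd_eq_qPochInf,
    qPochInf_dissect hq0.le hq1 q (d := 5) (by norm_num), ← h2, ← h3,
    show q ^ 5 / (q ^ 2) ^ 2 = q by field_simp, show q ^ 5 / q ^ 2 = q ^ 3 by field_simp]
  simp only [Finset.prod_range_succ, Finset.prod_range_zero, ← pow_succ', ← pow_mul,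
    Nat.reduceMul, Nat.reduceAdd, pow_one, one_mul]
  field_simp

lemma tprod_inv_eq {q : ℝ} (hq0 : 0 < q) (hq1 : q < 1) :
    ∏' n : ℕ, ((1 - q ^ (10 * n + 4)) * (1 - q ^ (10 * n + 6)))⁻¹ =
      (qPochInf (q ^ 10) (q ^ 4) * qPochInf (q ^ 10) (q ^ 6))⁻¹ := by
  have hp1 : q ^ 10 < 1 := pow_lt_one₀ hq0.le hq1 (by norm_num)
  have hp0 : 0 ≤ q ^ 10 := by positivity
  have hm (a : ℝ) : HasProd (fun i : ℕ => 1 - a * (q ^ 10) ^ i) (qPochInf (q ^ 10) a) := by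
    have := multipliable_one_add_of_summable (summable_norm_neg_mul_pow hp0 hp1 a)
    simp only [← sub_eq_add_neg] at this
    exact this.hasProd
  have h4 := (qPochInf_pos hp0 hp1 (by positivity)
    (pow_lt_one₀ hq0.le hq1 (n := 4) (by norm_num))).ne'
  have h6 := (qPochInf_pos hp0 hp1 (by positivity)
    (pow_lt_one₀ hq0.le hq1 (n := 6) (by norm_num))).ne'
  rw [← (((hm (q ^ 4)).mul (hm (q ^ 6))).inv₀ (mul_ne_zero h4 h6)).tprod_eq]
  exact tprod_congr fun n => by ring

lemma summable_zpow_quadratic {q : ℝ} (hq0 : 0 < q) (hq1 : q < 1) (b c : ℤ) :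
    Summable fun k : ℤ => q ^ (30 * k ^ 2 + b * k + c) := by
  refine (summable_rpow_quadratic hq0 hq1 (a := 30) (by norm_num) b c).congr fun k => ?_
  rw [← Real.rpow_intCast]
  push_cast
  rfl

lemma quintSeriesTerm_five_two {q : ℝ} (hq0 : 0 < q) (x : ℝ) :
    quintSeriesTerm (q ^ 5) (q ^ 2) x =
      q ^ ((15 * x ^ 2 + 7 * x) / 2) - q ^ ((15 * x ^ 2 + 17 * x) / 2 + 2) := by
  rw [quintSeriesTerm, ← Real.rpow_natCast, ← Real.rpow_natCast]
  simp only [← Real.rpow_mul hq0.le, ← Real.rpow_add hq0]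
  congr 2 <;> push_cast <;> ring

lemma quintSeriesTerm_five_two_even {q : ℝ} (hq0 : 0 < q) (k : ℤ) :
    quintSeriesTerm (q ^ 5) (q ^ 2) (2 * k : ℤ) =
      q ^ (30 * k ^ 2 + 7 * k) - q ^ (30 * k ^ 2 + 17 * k + 2) := by
  rw [quintSeriesTerm_five_two hq0, ← Real.rpow_intCast, ← Real.rpow_intCast]
  congr 2 <;> push_cast <;> ring

lemma quintSeriesTerm_five_two_odd {q : ℝ} (hq0 : 0 < q) (k : ℤ) :
    quintSeriesTerm (q ^ 5) (q ^ 2) (2 * k + 1 : ℤ) =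
      q ^ (30 * k ^ 2 + 37 * k + 11) - q ^ (30 * (k + 1) ^ 2 + (-13) * (k + 1) + 1) := by
  rw [quintSeriesTerm_five_two hq0, ← Real.rpow_intCast, ← Real.rpow_intCast]
  congr 2 <;> push_cast <;> ring

lemma theta_sum_eq_eulerProd_div {q : ℝ} (hq0 : 0 < q) (hq1 : q < 1) :
    ∑' k : ℤ, (q ^ (30 * k ^ 2 + 7 * k) - q ^ (30 * k ^ 2 + 17 * k + 2)) -
        ∑' k : ℤ, (q ^ (30 * k ^ 2 + (-13) * k + 1) - q ^ (30 * k ^ 2 + 37 * k + 11)) =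
      eulerProd q / (qPochInf (q ^ 10) (q ^ 4) * qPochInf (q ^ 10) (q ^ 6)) := by
  have hsum := summable_zpow_quadratic hq0 hq1
  have hshift := (Equiv.addRight (1 : ℤ)).tsum_eq fun k : ℤ => q ^ (30 * k ^ 2 + (-13) * k + 1)
  have hsum' := (Equiv.addRight (1 : ℤ)).summable_iff.mpr (hsum (-13) 1)
  simp only [Equiv.coe_addRight, Function.comp_def] at hshift hsum'
  rw [← tsum_quintSeriesTerm_five_two hq0 hq1,
    tsum_int_even_add_odd (f := fun j : ℤ => quintSeriesTerm (q ^ 5) (q ^ 2) j)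
      (summable_quintSeriesTerm (by positivity) (pow_lt_one₀ hq0.le hq1 (by norm_num))
        (by positivity))]
  simp only [quintSeriesTerm_five_two_even hq0, quintSeriesTerm_five_two_odd hq0]
  rw [(hsum 37 11).tsum_sub hsum', hshift, (hsum (-13) 1).tsum_sub (hsum 37 11), sub_sub_eq_add_sub,
    add_sub_assoc]

lemma minChar_five_six_two_one (q : ℝ) :
    minChar 5 6 2 1 q = q ^ ((11 : ℝ) / 30) * (eulerProd q)⁻¹ *
      ∑' k : ℤ, (q ^ (30 * k ^ 2 + 7 * k) - q ^ (30 * k ^ 2 + 17 * k + 2)) := by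
  rw [minChar]
  congr 2
  · norm_num
  · ext k
    congr 2
    ring

lemma minChar_five_six_two_five {q : ℝ} (hq0 : 0 < q) :
    minChar 5 6 2 5 q = q ^ ((11 : ℝ) / 30) * (eulerProd q)⁻¹ *
      ∑' k : ℤ, (q ^ (30 * k ^ 2 + (-13) * k + 1) - q ^ (30 * k ^ 2 + 37 * k + 11)) := by
  have h : ∑' k : ℤ, (q ^ (30 * k ^ 2 + (-13) * k + 1) - q ^ (30 * k ^ 2 + 37 * k + 11)) =
      q * ∑' k : ℤ, (q ^ (5 * 6 * k ^ 2 + k * (2 * 6 - 5 * 5)) -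
        q ^ (5 * 6 * k ^ 2 + (2 * 6 + 5 * 5) * k + 2 * 5)) := by
    rw [← tsum_mul_left]
    refine tsum_congr fun k => ?_
    rw [mul_sub, ← zpow_one_add₀ hq0.ne', ← zpow_one_add₀ hq0.ne']
    congr 2 <;> ring
  rw [h, minChar, mul_left_comm _ q, ← mul_assoc, ← mul_assoc, mul_comm q, ← Real.rpow_add_one hq0.ne']
  congr 3
  norm_num

theorem twisted_vacuum_character_product_form (q : ℝ) (hq0 : 0 < q) (hq1 : q < 1) :
    minChar 5 6 2 1 q - minChar 5 6 2 5 q =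
      q ^ ((11 : ℝ) / 30) *
        ∏' n : ℕ, ((1 - q ^ (10 * n + 4)) * (1 - q ^ (10 * n + 6)))⁻¹ := by
  have hE : eulerProd q ≠ 0 := by
    rw [eulerProd_eq_qPochInf]
    exact (qPochInf_pos hq0.le hq1 hq0.le hq1).ne'
  rw [minChar_five_six_two_one, minChar_five_six_two_five hq0, ← mul_sub,
    theta_sum_eq_eulerProd_div hq0 hq1, tprod_inv_eq hq0 hq1, mul_assoc,
    div_eq_mul_inv (eulerProd q), inv_mul_cancel_left₀ hE]
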